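/- The family of polynomials {π(J_{k,i}) : (k,i) ∈ T} in K[s] is algebraically independent over K. -/

import Mathlib

open Matrix MvPolynomial

/-- The index set `T = {(k,i) : 1 ≤ k ≤ n, 0 ≤ i ≤ k-1}`. -/
def TIdx (n : ℕ) := {p : ℕ × ℕ // p.1 ≤ n ∧ p.2 < p.1}

/-- The polynomial invariant `J_{k,i}` evaluated at a matrix `A`. -/
def Jki {n : ℕ} {R : Type*} [CommRing R] (k i : ℕ) (hk : k ≤ n) (hik : i < k)
    (A : Matrix (Fin n) (Fin n) R) : R :=
  Matrix.det (Matrix.of fun r c : Fin k =>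
    if h : (r : ℕ) < k - i then
      A ⟨n - (k - i) + (r : ℕ), by have := r.isLt; omega⟩
        ⟨(c : ℕ), by have := c.isLt; omega⟩
    else
      A.adjugate ⟨n - i + ((r : ℕ) - (k - i)), by have := r.isLt; omega⟩
        ⟨(c : ℕ), by have := c.isLt; omega⟩)

/-- The generic matrix `X = (x_{ab})` over the polynomial ring `K[x]`. -/
noncomputable def genMatrix (K : Type*) [CommRing K] (n : ℕ) :
    Matrix (Fin n) (Fin n) (MvPolynomial (Fin n × Fin n) K) :=
  Matrix.of fun a b => MvPolynomial.X (a, b)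

/-- The `K`-algebra homomorphism `π : K[x] → K[s]` with
`π(x_{ab}) = s_{b, a+b-n-1}` if `a + b ≥ n + 1` (1-indexed) and
`π(x_{ab}) = 0` if `a + b ≤ n`. -/
noncomputable def piHom (K : Type*) [CommRing K] (n : ℕ) :
    MvPolynomial (Fin n × Fin n) K →ₐ[K] MvPolynomial (TIdx n) K :=
  MvPolynomial.aeval fun ab =>
    if h : n ≤ (ab.1 : ℕ) + (ab.2 : ℕ) + 1 then
      MvPolynomial.X (⟨((ab.2 : ℕ) + 1, (ab.1 : ℕ) + (ab.2 : ℕ) + 1 - n),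
        by have := ab.1.isLt; have := ab.2.isLt; omega⟩ : TIdx n)
    else 0

/-- Entries of the minors, as a function of a doubly indexed family. -/
def mMat {K : Type*} [Field K] (i m : ℕ) (σ : ℕ → ℕ → K) : Matrix (Fin m) (Fin m) K :=
  Matrix.of fun r c => if m ≤ i + (r : ℕ) + (c : ℕ) + 1 then
    σ (i + (c : ℕ)) (i + (r : ℕ) + (c : ℕ) + 1 - m) else 0

/-- Change one value. -/
def upd {K : Type*} (σ : ℕ → ℕ → K) (b j : ℕ) (x : K) : ℕ → ℕ → K :=
  fun b' j' => if b' = b ∧ j' = j then x else σ b' j'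

theorem mMat_upd_of_ne {K : Type*} [Field K] (i m : ℕ) (σ : ℕ → ℕ → K) (b j : ℕ) (x : K)
    (h : i + m ≤ b ∨ (i + m = b + 1 ∧ j < i)) : mMat i m (upd σ b j x) = mMat i m σ := by
  ext r c
  have hr := r.isLt
  have hc := c.isLt
  simp only [mMat, upd, Matrix.of_apply]
  split_ifs <;> first | rfl | omega

theorem mMat_succ {K : Type*} [Field K] (i m : ℕ) (σ : ℕ → ℕ → K) :
    ∃ R : K, ∀ x : K, (mMat i (m + 1) (upd σ (i + m) i x)).det =
      (-1) ^ m * x * (mMat i m σ).det + R := by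
  refine ⟨∑ c : Fin m, (-1) ^ (c : ℕ) * mMat i (m + 1) σ 0 c.castSucc *
    ((mMat i (m + 1) σ).submatrix Fin.succ c.castSucc.succAbove).det, fun x => ?_⟩
  rw [Matrix.det_succ_row_zero, Fin.sum_univ_castSucc, add_comm]
  congr 1
  · have h1 : mMat i (m + 1) (upd σ (i + m) i x) 0 (Fin.last m) = x := by
      simp [mMat, upd]
      try omega
    have h2 : (mMat i (m + 1) (upd σ (i + m) i x)).submatrix Fin.succ (Fin.last m).succAbove
        = mMat i m σ := by
      ext r c
      have hc := c.isLt
      simp only [mMat, upd, Matrix.of_apply, Matrix.submatrix_apply, Fin.succAbove_last,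
        Fin.val_succ, Fin.val_castSucc]
      rw [if_neg (show ¬ (i + (c : ℕ) = i + m ∧ _) by omega)]
      by_cases h : m ≤ i + (r : ℕ) + (c : ℕ) + 1
      · rw [if_pos h, if_pos (by omega)]
        congr 1
        omega
      · rw [if_neg h, if_neg (by omega)]
    rw [h1, h2, Fin.val_last]
  · refine Finset.sum_congr rfl fun c _ => ?_
    have h1 : mMat i (m + 1) (upd σ (i + m) i x) 0 c.castSucc =
        mMat i (m + 1) σ 0 c.castSucc := by
      have hc := c.isLt
      simp only [mMat, upd, Matrix.of_apply, Fin.val_castSucc]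
      rw [if_neg (show ¬ (i + (c : ℕ) = i + m ∧ _) by omega)]
    have h2 : (mMat i (m + 1) (upd σ (i + m) i x)).submatrix Fin.succ c.castSucc.succAbove
        = (mMat i (m + 1) σ).submatrix Fin.succ c.castSucc.succAbove := by
      ext r d
      simp only [mMat, upd, Matrix.of_apply, Matrix.submatrix_apply, Fin.val_succ]
      split_ifs <;> first | rfl | omega
    rw [h1, h2, Fin.val_castSucc]

theorem solve_step {K : Type*} [Field K] (μ : ℕ → ℕ → K) (hμ : ∀ i m, μ i m ≠ 0) (N : ℕ)
    (h : ∃ σ : ℕ → ℕ → K, ∀ i m, 1 ≤ m → i + m ≤ N → (mMat i m σ).det = μ i m) (M : ℕ) :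
    ∃ σ : ℕ → ℕ → K, ∀ i m, 1 ≤ m → (i + m ≤ N ∨ (i + m = N + 1 ∧ m ≤ M)) →
      (mMat i m σ).det = μ i m := by
  induction M with
  | zero =>
    obtain ⟨σ, hσ⟩ := h
    exact ⟨σ, fun i m h1 h2 => hσ i m h1 (by omega)⟩
  | succ M ih =>
    obtain ⟨σ, hσ⟩ := ih
    by_cases hM : N < M
    · exact ⟨σ, fun i m h1 h2 => hσ i m h1 (by omega)⟩
    obtain ⟨i, rfl⟩ : ∃ i, N = i + M := ⟨N - M, by omega⟩
    obtain ⟨R, hR⟩ := mMat_succ i M σ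
    have hne : (mMat i M σ).det ≠ 0 := by
      rcases Nat.eq_zero_or_pos M with h0 | h0
      · subst h0
        simp
      · rw [hσ i M h0 (by omega)]
        exact hμ _ _
    have hs : ((-1 : K) ^ M) ≠ 0 := by simp
    refine ⟨upd σ (i + M) i ((μ i (M + 1) - R) / ((-1) ^ M * (mMat i M σ).det)),
      fun i' m' h1 h2 => ?_⟩
    by_cases h3 : m' = M + 1 ∧ i' = i
    · obtain ⟨rfl, rfl⟩ := h3
      rw [hR]
      field_simp
      ring
    · rw [mMat_upd_of_ne _ _ _ _ _ _ (by omega)]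
      exact hσ _ _ h1 (by omega)

theorem solve_all {K : Type*} [Field K] (μ : ℕ → ℕ → K) (hμ : ∀ i m, μ i m ≠ 0) (N : ℕ) :
    ∃ σ : ℕ → ℕ → K, ∀ i m, 1 ≤ m → i + m ≤ N → (mMat i m σ).det = μ i m := by
  induction N with
  | zero => exact ⟨fun _ _ => 0, fun i m h1 h2 => by omega⟩
  | succ N ih =>
    obtain ⟨σ, hσ⟩ := solve_step μ hμ N ih (N + 1)
    exact ⟨σ, fun i m h1 h2 => hσ i m h1 (by omega)⟩

theorem det_antiblock {K p q N : Type*} [Field K] [Fintype p] [DecidableEq p] [Fintype q]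
    [DecidableEq q] [Fintype N] [DecidableEq N] (e1 e2 : p ⊕ q ≃ N) :
    ∃ ε : K, ε ≠ 0 ∧ ∀ A : Matrix N N K, (∀ x y, A (e1 (Sum.inl x)) (e2 (Sum.inr y)) = 0) →
      A.det = ε * ((A.submatrix (e1 ∘ Sum.inl) (e2 ∘ Sum.inl)).det *
        (A.submatrix (e1 ∘ Sum.inr) (e2 ∘ Sum.inr)).det) := by
  set s : ℤˣ := Equiv.Perm.sign (e1.symm.trans e2) with hs
  have hs0 : (((s : ℤ) : K)) * ((s : ℤ) : K) = 1 := by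
    rw [← Int.cast_mul, ← Units.val_mul, Int.units_mul_self]
    simp
  refine ⟨((s : ℤ) : K), left_ne_zero_of_mul_eq_one hs0, fun A hA => ?_⟩
  have h1 : (A.submatrix e1 e2).det = ((s : ℤ) : K) * A.det := by
    rw [hs, ← Matrix.det_permute', ← Matrix.det_submatrix_equiv_self e1, Matrix.submatrix_submatrix]
    congr 2
    ext x
    simp
  have h2 : A.submatrix e1 e2 = Matrix.fromBlocks (A.submatrix (e1 ∘ Sum.inl) (e2 ∘ Sum.inl)) 0
      (A.submatrix (e1 ∘ Sum.inr) (e2 ∘ Sum.inl))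
      (A.submatrix (e1 ∘ Sum.inr) (e2 ∘ Sum.inr)) := by
    ext (x | x) (y | y) <;> simp [hA]
  rw [h2, Matrix.det_fromBlocks_zero₁₂] at h1
  rw [h1, ← mul_assoc, hs0, one_mul]

/-- first `i`, then the rest -/
def finA (i n : ℕ) (h : i ≤ n) : Fin i ⊕ Fin (n - i) ≃ Fin n :=
  finSumFinEquiv.trans (finCongr (by omega))

/-- last `i`, then the rest -/
def finB (i n : ℕ) (h : i ≤ n) : Fin i ⊕ Fin (n - i) ≃ Fin n :=
  (Equiv.sumComm _ _).trans (finSumFinEquiv.trans (finCongr (by omega)))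

theorem finA_inl (i n : ℕ) (h : i ≤ n) (x : Fin i) : ((finA i n h (Sum.inl x) : Fin n) : ℕ) = x := by
  simp [finA]
theorem finA_inr (i n : ℕ) (h : i ≤ n) (x : Fin (n - i)) :
    ((finA i n h (Sum.inr x) : Fin n) : ℕ) = i + x := by
  simp [finA]
theorem finB_inl (i n : ℕ) (h : i ≤ n) (x : Fin i) :
    ((finB i n h (Sum.inl x) : Fin n) : ℕ) = n - i + x := by
  simp [finB]
theorem finB_inr (i n : ℕ) (h : i ≤ n) (x : Fin (n - i)) :
    ((finB i n h (Sum.inr x) : Fin n) : ℕ) = x := by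
  simp [finB]

/-- The relevant minor of the adjugate. -/
theorem adj_minor {K : Type*} [Field K] (n i : ℕ) (hi : i ≤ n) :
    ∃ ε : K, ε ≠ 0 ∧ ∀ σ : ℕ → ℕ → K, (mMat 0 (n - i) σ).det ≠ 0 →
      (∀ x y, (mMat 0 n σ).adjugate (finB i n hi (Sum.inl x)) (finA i n hi (Sum.inr y)) = 0) ∧
      ((mMat 0 n σ).adjugate.submatrix (finB i n hi ∘ Sum.inl) (finA i n hi ∘ Sum.inl)).det *
        (mMat 0 n σ).det = ε * ((mMat 0 n σ).det ^ i * (mMat 0 (n - i) σ).det) := by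
  obtain ⟨ε, hε, H⟩ := det_antiblock (K := K) (finA i n hi) (finB i n hi)
  refine ⟨ε, hε, fun σ hC => ?_⟩
  set S := mMat 0 n σ with hS
  have hz : ∀ x y, S (finA i n hi (Sum.inl x)) (finB i n hi (Sum.inr y)) = 0 := by
    intro x y
    have := x.isLt
    have := y.isLt
    simp only [hS, mMat, Matrix.of_apply, finA_inl, finB_inr]
    rw [if_neg (by omega)]
  have hCe : S.submatrix (finA i n hi ∘ Sum.inr) (finB i n hi ∘ Sum.inr) = mMat 0 (n - i) σ := by
    ext x y
    have := x.isLt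
    have := y.isLt
    simp only [hS, mMat, Matrix.of_apply, Matrix.submatrix_apply, Function.comp, finA_inr, finB_inr]
    by_cases h : n ≤ 0 + (i + (x : ℕ)) + (y : ℕ) + 1
    · rw [if_pos h, if_pos (by omega)]
      congr 1
      omega
    · rw [if_neg h, if_neg (by omega)]
  have hdet := H S hz
  rw [hCe] at hdet
  set B := S.submatrix (finA i n hi ∘ Sum.inl) (finB i n hi ∘ Sum.inl) with hB
  set Rm := S.adjugate.submatrix (finB i n hi ∘ Sum.inl) (finA i n hi ∘ Sum.inl) with hRm
  set Tm := S.adjugate.submatrix (finB i n hi ∘ Sum.inl) (finA i n hi ∘ Sum.inr) with hTm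
  have hmul := Matrix.adjugate_mul S
  have key : ∀ a b, ∑ x, S.adjugate (finB i n hi a) (finA i n hi (Sum.inl x)) *
        S (finA i n hi (Sum.inl x)) (finB i n hi b) +
      ∑ y, S.adjugate (finB i n hi a) (finA i n hi (Sum.inr y)) *
        S (finA i n hi (Sum.inr y)) (finB i n hi b) = if a = b then S.det else 0 := by
    intro a b
    have := congrFun (congrFun hmul (finB i n hi a)) (finB i n hi b)
    rw [Matrix.mul_apply, ← (finA i n hi).sum_comp, Fintype.sum_sum_type] at this
    rw [this]
    simp [Matrix.smul_apply, Matrix.one_apply]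
  have hTC : Tm * mMat 0 (n - i) σ = 0 := by
    ext x y
    have := key (Sum.inl x) (Sum.inr y)
    simp only [hz, mul_zero, Finset.sum_const_zero, zero_add, reduceCtorEq, if_false] at this
    rw [← hCe, Matrix.mul_apply]
    exact this
  have hT : Tm = 0 := by
    have hu : IsUnit (mMat 0 (n - i) σ).det := isUnit_iff_ne_zero.mpr hC
    have := congrArg (· * (mMat 0 (n - i) σ)⁻¹) hTC
    simpa [Matrix.mul_assoc, Matrix.mul_nonsing_inv _ hu] using this
  have hT' : ∀ x y, S.adjugate (finB i n hi (Sum.inl x)) (finA i n hi (Sum.inr y)) = 0 :=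
    fun x y => congrFun (congrFun hT x) y
  refine ⟨hT', ?_⟩
  have hRB : Rm * B = S.det • (1 : Matrix (Fin i) (Fin i) K) := by
    ext x y
    have := key (Sum.inl x) (Sum.inl y)
    simp only [hT', zero_mul, Finset.sum_const_zero, add_zero] at this
    rw [Matrix.mul_apply]
    refine Eq.trans this ?_
    simp [Matrix.one_apply]
  have hd := congrArg Matrix.det hRB
  rw [Matrix.det_mul, Matrix.det_smul, Matrix.det_one, mul_one, Fintype.card_fin] at hd
  calc Rm.det * S.det = Rm.det * (ε * (B.det * (mMat 0 (n - i) σ).det)) := by rw [← hdet]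
    _ = ε * ((Rm.det * B.det) * (mMat 0 (n - i) σ).det) := by ring
    _ = _ := by rw [hd]

theorem Jki_factor {K : Type*} [Field K] (n k i : ℕ) (hk : k ≤ n) (hik : i < k) :
    ∃ ε : K, ε ≠ 0 ∧ ∀ σ : ℕ → ℕ → K, (mMat 0 (n - i) σ).det ≠ 0 → (mMat 0 n σ).det ≠ 0 →
      Jki k i hk hik (mMat 0 n σ) = ε * ((mMat 0 n σ).det ^ i * (mMat 0 (n - i) σ).det /
        (mMat 0 n σ).det) * (mMat i (k - i) σ).det := by
  have hi : i ≤ n := by omega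
  obtain ⟨ε, hε, H⟩ := adj_minor (K := K) n i hi
  obtain ⟨δ, hδ, H'⟩ := det_antiblock (K := K) (finB i k hik.le) (finA i k hik.le)
  refine ⟨δ * ε, mul_ne_zero hδ hε, fun σ hC hD => ?_⟩
  obtain ⟨hz, hF⟩ := H σ hC
  have hF' : ((mMat 0 n σ).adjugate.submatrix (finB i n hi ∘ Sum.inl)
      (finA i n hi ∘ Sum.inl)).det = ε * ((mMat 0 n σ).det ^ i * (mMat 0 (n - i) σ).det) /
        (mMat 0 n σ).det := by
    rw [eq_div_iff hD, hF]
  unfold Jki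
  rw [H' _ ?_]
  · have e1 : ∀ A : Matrix (Fin k) (Fin k) K, A = A := fun _ => rfl
    have hA1 : ((Matrix.of fun r c : Fin k =>
        if h : (r : ℕ) < k - i then
          (mMat 0 n σ) ⟨n - (k - i) + (r : ℕ), by have := r.isLt; omega⟩
            ⟨(c : ℕ), by have := c.isLt; omega⟩
        else
          (mMat 0 n σ).adjugate ⟨n - i + ((r : ℕ) - (k - i)), by have := r.isLt; omega⟩
            ⟨(c : ℕ), by have := c.isLt; omega⟩).submatrix
          (finB i k hik.le ∘ Sum.inl) (finA i k hik.le ∘ Sum.inl)) =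
        (mMat 0 n σ).adjugate.submatrix (finB i n hi ∘ Sum.inl) (finA i n hi ∘ Sum.inl) := by
      ext x y
      simp only [Matrix.submatrix_apply, Function.comp, Matrix.of_apply]
      rw [dif_neg (by rw [finB_inl]; omega)]
      congr 1
      · ext
        simp only [finB_inl]
        omega
    have hA2 : ((Matrix.of fun r c : Fin k =>
        if h : (r : ℕ) < k - i then
          (mMat 0 n σ) ⟨n - (k - i) + (r : ℕ), by have := r.isLt; omega⟩
            ⟨(c : ℕ), by have := c.isLt; omega⟩
        else
          (mMat 0 n σ).adjugate ⟨n - i + ((r : ℕ) - (k - i)), by have := r.isLt; omega⟩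
            ⟨(c : ℕ), by have := c.isLt; omega⟩).submatrix
          (finB i k hik.le ∘ Sum.inr) (finA i k hik.le ∘ Sum.inr)) = mMat i (k - i) σ := by
      ext x y
      have := x.isLt
      have := y.isLt
      simp only [Matrix.submatrix_apply, Function.comp, Matrix.of_apply]
      rw [dif_pos (by rw [finB_inr]; omega)]
      simp only [mMat, Matrix.of_apply, finB_inr, finA_inr]
      by_cases h : k - i ≤ i + (x : ℕ) + (y : ℕ) + 1
      · rw [if_pos h, if_pos (by omega)]
        congr 1
        · omega
        · omega
      · rw [if_neg h, if_neg (by omega)]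
    rw [hA1, hA2, hF']
    ring
  · intro x y
    have := y.isLt
    simp only [Matrix.of_apply]
    rw [dif_neg (by rw [finB_inl]; omega)]
    rw [← hz x ⟨y, by omega⟩]
    congr 1
    · ext
      simp only [finB_inl]
      omega

theorem Jki_surj {K : Type*} [Field K] (n : ℕ) (hn : 1 ≤ n) (c : ℕ → ℕ → K)
    (hc : ∀ k i, c k i ≠ 0) :
    ∃ σ : ℕ → ℕ → K, ∀ k i (hk : k ≤ n) (hik : i < k), Jki k i hk hik (mMat 0 n σ) = c k i := by
  have hex : ∀ k i, ∃ ε : K, ε ≠ 0 ∧ ∀ (hk : k ≤ n) (hik : i < k) (σ : ℕ → ℕ → K),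
      (mMat 0 (n - i) σ).det ≠ 0 → (mMat 0 n σ).det ≠ 0 →
      Jki k i hk hik (mMat 0 n σ) = ε * ((mMat 0 n σ).det ^ i * (mMat 0 (n - i) σ).det /
        (mMat 0 n σ).det) * (mMat i (k - i) σ).det := by
    intro k i
    by_cases h : k ≤ n ∧ i < k
    · obtain ⟨ε, h1, h2⟩ := Jki_factor (K := K) n k i h.1 h.2
      exact ⟨ε, h1, fun _ _ => h2⟩
    · exact ⟨1, one_ne_zero, fun h1 h2 => absurd ⟨h1, h2⟩ h⟩
  choose ε hε H using hex
  let μ0 : ℕ → K := fun k => c k 0 / ε k 0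
  have hμ0 : ∀ k, μ0 k ≠ 0 := fun k => div_ne_zero (hc _ _) (hε _ _)
  let μ : ℕ → ℕ → K := fun i m =>
    c (i + m) i / (ε (i + m) i * (μ0 n ^ i * μ0 (n - i) / μ0 n))
  have hμ : ∀ i m, μ i m ≠ 0 := fun i m => div_ne_zero (hc _ _)
    (mul_ne_zero (hε _ _) (div_ne_zero (mul_ne_zero (pow_ne_zero _ (hμ0 _)) (hμ0 _)) (hμ0 _)))
  have hμμ : ∀ m, μ 0 m = μ0 m := by
    intro m
    simp only [μ, zero_add, pow_zero, one_mul, Nat.sub_zero]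
    rw [div_self (hμ0 n), mul_one]
  obtain ⟨σ, hσ⟩ := solve_all μ hμ n
  refine ⟨σ, fun k i hk hik => ?_⟩
  have h1 : (mMat 0 n σ).det = μ0 n := by rw [hσ 0 n hn (by omega), hμμ]
  have h2 : (mMat 0 (n - i) σ).det = μ0 (n - i) := by
    rw [hσ 0 (n - i) (by omega) (by omega), hμμ]
  rw [H k i hk hik σ (by rw [h2]; exact hμ0 _) (by rw [h1]; exact hμ0 _), h1, h2,
    hσ i (k - i) (by omega) (by omega)]
  have h3 : i + (k - i) = k := by omega
  simp only [μ, h3]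
  rw [mul_div_cancel₀]
  exact mul_ne_zero (hε _ _) (div_ne_zero (mul_ne_zero (pow_ne_zero _ (hμ0 _)) (hμ0 _)) (hμ0 _))

theorem Jki_map {n : ℕ} {R R' : Type*} [CommRing R] [CommRing R'] (f : R →+* R') (k i : ℕ)
    (hk : k ≤ n) (hik : i < k) (A : Matrix (Fin n) (Fin n) R) :
    f (Jki k i hk hik A) = Jki k i hk hik (f.mapMatrix A) := by
  unfold Jki
  rw [RingHom.map_det, ← RingHom.map_adjugate]
  congr 1
  ext r c
  simp only [RingHom.mapMatrix_apply, Matrix.map_apply, Matrix.of_apply]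
  split_ifs <;> rfl

instance TIdx.finite (n : ℕ) : Finite (TIdx n) := by
  unfold TIdx
  refine Set.Finite.to_subtype (s := {p : ℕ × ℕ | p.1 ≤ n ∧ p.2 < p.1}) ?_
  refine ((Set.finite_Iic n).prod (Set.finite_Iic n)).subset ?_
  rintro ⟨a, b⟩ h
  simp only [Set.mem_ofPred_eq] at h
  simp only [Set.mem_prod, Set.mem_Iic]
  omega

/-- The family `{π(J_{k,i}) : (k,i) ∈ T}` of polynomials in `K[s]` is
algebraically independent over `K`. -/
theorem piHom_Jki_algebraicIndependent {n : ℕ} {K : Type*} [Field K]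
    [CharZero K] (hn : 1 ≤ n) :
    AlgebraicIndependent K
      (fun t : TIdx n =>
        piHom K n (Jki t.1.1 t.1.2 t.2.1 t.2.2 (genMatrix K n))) := by
  classical
  have := Fintype.ofFinite (TIdx n)
  rw [algebraicIndependent_iff]
  intro p hp
  have hev : ∀ c : TIdx n → K, (∀ t, c t ≠ 0) → MvPolynomial.eval c p = 0 := by
    intro c hc
    obtain ⟨σ, hσ⟩ := Jki_surj n hn
      (fun k i => if h : k ≤ n ∧ i < k then c ⟨(k, i), h⟩ else 1) (by
        intro k i
        by_cases h : k ≤ n ∧ i < k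
        · simp only [dif_pos h]
          exact hc _
        · simp only [dif_neg h]
          exact one_ne_zero)
    let τ : TIdx n → K := fun t => σ (t.1.1 - 1) t.1.2
    have hJ : ∀ t : TIdx n, MvPolynomial.aeval τ
        (piHom K n (Jki t.1.1 t.1.2 t.2.1 t.2.2 (genMatrix K n))) = c t := by
      intro t
      have h0 := hσ t.1.1 t.1.2 t.2.1 t.2.2
      rw [dif_pos t.2] at h0
      refine Eq.trans ?_ h0
      have := Jki_map (((MvPolynomial.aeval τ).comp (piHom K n) :
        MvPolynomial (Fin n × Fin n) K →ₐ[K] K) : MvPolynomial (Fin n × Fin n) K →+* K)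
        t.1.1 t.1.2 t.2.1 t.2.2 (genMatrix K n)
      refine Eq.trans this ?_
      congr 1
      ext a b
      simp only [RingHom.mapMatrix_apply, Matrix.map_apply, genMatrix, Matrix.of_apply, mMat,
        RingHom.coe_coe, AlgHom.comp_apply, piHom, MvPolynomial.aeval_X, zero_add]
      split_ifs with h
      · exact MvPolynomial.aeval_X τ _
      · simp
    have h1 := congrArg (MvPolynomial.aeval τ) hp
    rw [map_zero, MvPolynomial.comp_aeval_apply] at h1
    simp only [hJ] at h1
    rw [← h1, MvPolynomial.aeval_eq_eval]
  have hprod : p * ∏ t : TIdx n, MvPolynomial.X t = 0 := by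
    apply MvPolynomial.funext
    intro c
    rw [map_mul, map_prod, map_zero]
    by_cases h : ∀ t, c t ≠ 0
    · rw [hev c h, zero_mul]
    · push Not at h
      obtain ⟨t, ht⟩ := h
      rw [Finset.prod_eq_zero (Finset.mem_univ t) (by simpa using ht), mul_zero]
  rcases mul_eq_zero.mp hprod with h | h
  · exact h
  · exact absurd h (Finset.prod_ne_zero_iff.mpr fun t _ => MvPolynomial.X_ne_zero t)
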